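/- arXiv:2001.02797 — 2 statements merged into one kernel-verified Lean document; each statement's English description precedes it below -/
import Mathlib

section
/- Let S = X₁ + ⋯ + Xₙ be a sum of independent Bernoulli(p_i) random variables, x = ∑ p_i, p = max_i p_i < 1, and X ~ Poisson(x). If h : ℕ → ℝ satisfies E[|Δ²h(X)|] ≤ ν < ∞, then |E[h(S)] - E[h(X)]| ≤ (x ν / 2) · p e^p / (1 - p)². -/
open scoped BigOperators

/-- Probability mass function of the Poisson distribution with parameter `x`. -/
noncomputable def poiPMF (x : ℝ) (k : ℕ) : ℝ := Real.exp (-x) * x ^ k / (Nat.factorial k)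

/-- Probability of an outcome `u` for `n` independent Bernoulli(`p i`) random variables. -/
noncomputable def bernProb {n : ℕ} (p : Fin n → ℝ) (u : Fin n → Bool) : ℝ :=
  ∏ i, if u i then p i else 1 - p i

/-- The value of the sum `S = X₁ + ⋯ + Xₙ` on the outcome `u`. -/
def countOnes {n : ℕ} (u : Fin n → Bool) : ℕ := ∑ i, if u i then 1 else 0

open PowerSeries in
/-- Generating function of the Bernoulli(`q`) distribution. -/
noncomputable def bernSeries (q : ℝ) : PowerSeries ℝ := C (1 - q) + C q * X

/-- Generating function of the Poisson(`x`) distribution. -/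
noncomputable def poiSeries (x : ℝ) : PowerSeries ℝ := PowerSeries.mk (poiPMF x)

/-- The coefficients of `P` are at most those of `Q`. -/
def CoeffLE (P Q : PowerSeries ℝ) : Prop := ∀ k, PowerSeries.coeff k P ≤ PowerSeries.coeff k Q

section CoeffLE

open PowerSeries

theorem CoeffLE.trans {P Q R : PowerSeries ℝ} (h₁ : CoeffLE P Q) (h₂ : CoeffLE Q R) :
    CoeffLE P R := fun k => (h₁ k).trans (h₂ k)

theorem CoeffLE.mul_left {A P Q : PowerSeries ℝ} (hA : CoeffLE 0 A) (h : CoeffLE P Q) :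
    CoeffLE (A * P) (A * Q) := fun k => by
  rw [coeff_mul, coeff_mul]
  exact Finset.sum_le_sum fun m _ => mul_le_mul_of_nonneg_left (h m.2) (by simpa using hA m.1)

theorem CoeffLE.mul {A B P Q : PowerSeries ℝ} (hA : CoeffLE 0 A) (hQ : CoeffLE 0 Q)
    (hAB : CoeffLE A B) (hPQ : CoeffLE P Q) : CoeffLE (A * P) (B * Q) := by
  refine (hA.mul_left hPQ).trans ?_
  rw [mul_comm A, mul_comm B]
  exact hQ.mul_left hAB

theorem CoeffLE.mul_nonneg {A B : PowerSeries ℝ} (hA : CoeffLE 0 A) (hB : CoeffLE 0 B) :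
    CoeffLE 0 (A * B) := by
  simpa using hA.mul_left hB

theorem CoeffLE.C_mul_left {c : ℝ} (hc : 0 ≤ c) {P Q : PowerSeries ℝ} (h : CoeffLE P Q) :
    CoeffLE (C c * P) (C c * Q) := fun k => by
  simpa [coeff_C_mul] using mul_le_mul_of_nonneg_left (h k) hc

theorem CoeffLE.C_mul_right {c d : ℝ} (hcd : c ≤ d) {P : PowerSeries ℝ} (hP : CoeffLE 0 P) :
    CoeffLE (C c * P) (C d * P) := fun k => by
  simpa [coeff_C_mul] using mul_le_mul_of_nonneg_right hcd (by simpa using hP k)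

theorem CoeffLE.C_mul_nonneg {c : ℝ} (hc : 0 ≤ c) {P : PowerSeries ℝ} (hP : CoeffLE 0 P) :
    CoeffLE 0 (C c * P) := by
  simpa using hP.C_mul_left hc

theorem CoeffLE.prod_nonneg {ι : Type*} {s : Finset ι} {f : ι → PowerSeries ℝ}
    (h : ∀ i ∈ s, CoeffLE 0 (f i)) : CoeffLE 0 (∏ i ∈ s, f i) := by
  classical
  induction s using Finset.induction_on with
  | empty =>
    intro k
    simp only [Finset.prod_empty, map_zero, coeff_one]
    split_ifs <;> norm_num
  | insert a s ha ih =>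
    rw [Finset.prod_insert ha]
    exact (h a (Finset.mem_insert_self a s)).mul_nonneg
      (ih fun i hi => h i (Finset.mem_insert_of_mem hi))

end CoeffLE

section Poisson

open PowerSeries

theorem poiPMF_nonneg {x : ℝ} (hx : 0 ≤ x) (k : ℕ) : 0 ≤ poiPMF x k := by
  unfold poiPMF
  positivity

@[simp]
theorem coeff_poiSeries (x : ℝ) (k : ℕ) : coeff k (poiSeries x) = poiPMF x k := coeff_mk _ _

theorem poiSeries_nonneg {x : ℝ} (hx : 0 ≤ x) : CoeffLE 0 (poiSeries x) := fun k => by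
  simpa using poiPMF_nonneg hx k

theorem poiSeries_zero : poiSeries 0 = 1 := by
  ext k
  rcases k with _ | k <;> simp [poiPMF, coeff_one]

theorem poiSeries_add (x y : ℝ) : poiSeries (x + y) = poiSeries x * poiSeries y := by
  ext k
  simp only [coeff_mul, coeff_poiSeries, poiPMF]
  rw [(Commute.all x y).add_pow', Finset.mul_sum, Finset.sum_div]
  refine Finset.sum_congr rfl fun m hm => ?_
  rw [Finset.HasAntidiagonal.mem_antidiagonal] at hm
  have h : (k.choose m.1 : ℝ) * m.1.factorial * m.2.factorial = k.factorial := by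
    have := Nat.choose_mul_factorial_mul_factorial (show m.1 ≤ k by omega)
    rw [show k - m.1 = m.2 by omega] at this
    exact_mod_cast this
  have := Nat.choose_pos (show m.1 ≤ k by omega)
  rw [neg_add, Real.exp_add, nsmul_eq_mul, ← h]
  field_simp

theorem hasSum_poiPMF (x : ℝ) : HasSum (poiPMF x) 1 := by
  have h := (NormedSpace.expSeries_div_hasSum_exp x).mul_left (Real.exp (-x))
  rw [← Real.exp_eq_exp_ℝ, ← Real.exp_add, neg_add_cancel, Real.exp_zero] at h
  rw [show poiPMF x = fun k => Real.exp (-x) * (x ^ k / k.factorial) from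
    funext fun k => mul_div_assoc _ _ _]
  exact h

theorem succ_mul_poiPMF_succ (x : ℝ) (k : ℕ) : (k + 1) * poiPMF x (k + 1) = x * poiPMF x k := by
  unfold poiPMF
  rw [Nat.factorial_succ, pow_succ]
  push_cast
  field_simp

theorem hasSum_nat_mul_poiPMF (x : ℝ) : HasSum (fun k : ℕ => (k : ℝ) * poiPMF x k) x := by
  rw [← hasSum_nat_add_iff' 1]
  simpa [succ_mul_poiPMF_succ] using (hasSum_poiPMF x).mul_left x

end Poisson

section Binomial

open PowerSeries

theorem bernSeries_eq (q : ℝ) : bernSeries q = 1 + C q * (X - 1) := by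
  simp only [bernSeries, map_sub, map_one]
  ring

theorem bernSeries_zero : bernSeries 0 = 1 := by
  simp [bernSeries]

theorem bernSeries_nonneg {q : ℝ} (h0 : 0 ≤ q) (h1 : q ≤ 1) : CoeffLE 0 (bernSeries q) := by
  intro k
  rcases k with _ | _ | k <;> simp [bernSeries, coeff_C, h0, h1]

theorem coeff_bernSeries_pow (q : ℝ) (n k : ℕ) :
    coeff k (bernSeries q ^ n) = n.choose k * q ^ k * (1 - q) ^ (n - k) := by
  have h : bernSeries q ^ n =
      ∑ m ∈ Finset.range (n + 1), C (n.choose m * q ^ m * (1 - q) ^ (n - m)) * X ^ m := by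
    rw [bernSeries, add_comm, add_pow]
    refine Finset.sum_congr rfl fun m _ => ?_
    rw [mul_pow, ← map_pow, ← map_pow, ← map_natCast (C : ℝ →+* PowerSeries ℝ), map_mul, map_mul]
    ring
  rw [h, map_sum]
  simp only [coeff_C_mul, coeff_X_pow, mul_ite, mul_one, mul_zero, Finset.sum_ite_eq,
    Finset.mem_range]
  split_ifs with hk
  · rfl
  · rw [Nat.choose_eq_zero_of_lt (by omega)]
    simp

theorem factorial_mul_pow_mul_exp_le (m k : ℕ) :
    ((m + 1 + k).factorial : ℝ) * (m + 1) ^ (m + 1) * Real.exp k ≤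
      m.factorial * (m + 1 + k) ^ (m + 1 + k + 1) := by
  induction k with
  | zero =>
    simp only [add_zero, Nat.factorial_succ, Nat.cast_zero, Real.exp_zero]
    push_cast
    apply le_of_eq
    ring
  | succ k ih =>
    have key : Real.exp 1 * (m + 1 + k : ℝ) ^ (m + 1 + k + 1) ≤
        (m + 1 + k + 1 : ℝ) ^ (m + 1 + k + 1) := by
      have hpos : (0 : ℝ) < m + 1 + k + 1 := by positivity
      have h1 := Real.one_sub_div_pow_le_exp_neg (n := m + 1 + k + 1) (t := 1)
        (by push_cast; linarith [hpos, (by positivity : (0 : ℝ) ≤ m + 1 + k)])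
      push_cast at h1
      have h2 : (1 - 1 / (m + 1 + k + 1 : ℝ)) = (m + 1 + k) / (m + 1 + k + 1) := by
        field_simp
        ring
      rw [h2, div_pow, Real.exp_neg, div_le_iff₀ (by positivity)] at h1
      calc _ ≤ Real.exp 1 * ((Real.exp 1)⁻¹ * (m + 1 + k + 1 : ℝ) ^ (m + 1 + k + 1)) := by gcongr
        _ = _ := by field_simp
    have h3 : (m + 1 + (k + 1)).factorial = (m + 1 + k + 1) * (m + 1 + k).factorial :=
      Nat.factorial_succ (m + 1 + k)
    rw [h3]
    push_cast
    rw [Real.exp_add]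
    calc _ = (m + 1 + k + 1) * Real.exp 1 *
          ((m + 1 + k).factorial * (m + 1) ^ (m + 1) * Real.exp k : ℝ) := by ring
      _ ≤ (m + 1 + k + 1) * Real.exp 1 * (m.factorial * (m + 1 + k) ^ (m + 1 + k + 1)) := by
        gcongr
      _ = (m + 1 + k + 1) * m.factorial * (Real.exp 1 * (m + 1 + k : ℝ) ^ (m + 1 + k + 1)) := by
        ring
      _ ≤ (m + 1 + k + 1) * m.factorial * (m + 1 + k + 1 : ℝ) ^ (m + 1 + k + 1) := by gcongr
      _ = _ := by ring

theorem pow_mul_exp_le (m : ℕ) {n y : ℝ} (hn : 0 < n) (hy : 0 ≤ y) :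
    y ^ (m + 1) * n ^ (m + 1) * Real.exp (n * (1 - y)) ≤
      (m + 1) ^ (m + 1) * Real.exp (n - (m + 1)) := by
  have hm : (0 : ℝ) < m + 1 := by positivity
  have h1 : y * n / (m + 1) ≤ Real.exp (y * n / (m + 1) - 1) := by
    linarith [Real.add_one_le_exp (y * n / (m + 1) - 1)]
  have h2 : (y * n / (m + 1)) ^ (m + 1) ≤ Real.exp (y * n - (m + 1)) := by
    calc _ ≤ Real.exp (y * n / (m + 1) - 1) ^ (m + 1) := by gcongr
      _ = _ := by
        rw [← Real.exp_nat_mul]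
        congr 1
        push_cast
        field_simp
  rw [div_pow, div_le_iff₀ (by positivity), mul_pow] at h2
  calc _ ≤ Real.exp (y * n - (m + 1)) * (m + 1) ^ (m + 1) * Real.exp (n * (1 - y)) := by gcongr
    _ = (m + 1) ^ (m + 1) * (Real.exp (y * n - (m + 1)) * Real.exp (n * (1 - y))) := by ring
    _ = _ := by
      rw [← Real.exp_add]
      congr 2
      ring

theorem binomial_le_poiPMF {q : ℝ} (h0 : 0 ≤ q) (h1 : q < 1) (n k : ℕ) :
    n.choose k * q ^ k * (1 - q) ^ (n - k) ≤ (1 - q)⁻¹ * poiPMF (n * q) k := by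
  have hq : 0 < 1 - q := by linarith
  rcases lt_or_ge n k with hk | hk
  · rw [Nat.choose_eq_zero_of_lt hk]
    have := poiPMF_nonneg (mul_nonneg (Nat.cast_nonneg n) h0) k
    simp only [Nat.cast_zero, zero_mul]
    positivity
  obtain ⟨m, rfl⟩ := Nat.exists_eq_add_of_le' hk
  rw [Nat.add_sub_cancel]
  suffices H : ((m + k).choose k * k.factorial : ℝ) * (1 - q) ^ (m + 1) *
      Real.exp ((m + k : ℕ) * q) ≤ ((m + k : ℕ) : ℝ) ^ k by
    unfold poiPMF
    rw [inv_mul_eq_div, le_div_iff₀ hq, le_div_iff₀ (by positivity), Real.exp_neg,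
      inv_mul_eq_div, le_div_iff₀ (by positivity), mul_pow]
    calc _ = (((m + k).choose k * k.factorial : ℝ) * (1 - q) ^ (m + 1) *
          Real.exp ((m + k : ℕ) * q)) * q ^ k := by ring
      _ ≤ _ := by gcongr
  rcases k with _ | k
  · simp only [add_zero, Nat.choose_zero_right, Nat.factorial_zero, Nat.cast_one, mul_one, one_mul,
      pow_zero]
    have h2 : 1 - q ≤ Real.exp (-q) := by linarith [Real.add_one_le_exp (-q)]
    calc (1 - q) ^ (m + 1) * Real.exp (m * q) ≤ Real.exp (-q) ^ (m + 1) * Real.exp (m * q) := by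
          gcongr
      _ = Real.exp (-q) := by
        rw [← Real.exp_nat_mul, ← Real.exp_add]
        congr 1
        push_cast
        ring
      _ ≤ 1 := Real.exp_le_one_iff.2 (by linarith)
  · have hA := factorial_mul_pow_mul_exp_le m k
    have hB := pow_mul_exp_le m (n := m + 1 + k) (by positivity) hq.le
    have hC : ((m + (k + 1)).choose (k + 1) * (k + 1).factorial : ℝ) * m.factorial =
        (m + 1 + k).factorial := by
      have := Nat.add_choose_mul_factorial_mul_factorial m (k + 1)
      rw [show m + 1 + k = m + (k + 1) by ring, ← this]
      push_cast
      ring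
    rw [show (m + 1 + k : ℝ) - (m + 1) = k by ring, show 1 - (1 - q) = q by ring] at hB
    have hN : ((m + (k + 1) : ℕ) : ℝ) = m + 1 + k := by push_cast; ring
    rw [hN]
    have hpos : (0 : ℝ) < m.factorial * (m + 1 + k : ℝ) ^ (m + 1) := by positivity
    refine le_of_mul_le_mul_right ?_ hpos
    calc _ = (m + 1 + k).factorial * ((1 - q) ^ (m + 1) * (m + 1 + k : ℝ) ^ (m + 1) *
          Real.exp ((m + 1 + k) * q)) := by rw [← hC]; ring
      _ ≤ (m + 1 + k).factorial * ((m + 1) ^ (m + 1) * Real.exp k) := by gcongr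
      _ = (m + 1 + k).factorial * (m + 1) ^ (m + 1) * Real.exp k := by ring
      _ ≤ m.factorial * (m + 1 + k) ^ (m + 1 + k + 1) := hA
      _ = _ := by ring

theorem bernSeries_pow_le {q : ℝ} (h0 : 0 ≤ q) (h1 : q < 1) (n : ℕ) :
    CoeffLE (bernSeries q ^ n) (C (1 - q)⁻¹ * poiSeries (n * q)) := fun k => by
  rw [coeff_bernSeries_pow, coeff_C_mul, coeff_poiSeries]
  exact binomial_le_poiPMF h0 h1 n k

end Binomial

section Extremal

open PowerSeries

variable {ι : Type*}

theorem continuous_coeff_prod_bernSeries (s : Finset ι) (k : ℕ) :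
    Continuous fun q : ι → ℝ => coeff k (∏ i ∈ s, bernSeries (q i)) := by
  classical
  induction s using Finset.induction_on generalizing k with
  | empty => simpa using continuous_const
  | insert a s ha ih =>
    simp only [Finset.prod_insert ha, coeff_mul]
    refine continuous_finsetSum _ fun m _ => Continuous.mul ?_ (ih m.2)
    simp only [bernSeries, map_add, coeff_C_mul, coeff_C]
    split_ifs <;> fun_prop

/-- Replacing `q i` and `q j` by numbers `a` and `b` with the same sum changes a coefficient of
the generating function by a multiple of `a * b - q i * q j` that does not depend on `a`, `b`. -/
theorem exists_coeff_prod_bernSeries_update [DecidableEq ι] (s : Finset ι) (k : ℕ) (q : ι → ℝ)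
    {i j : ι} (hi : i ∈ s) (hj : j ∈ s) (hij : i ≠ j) :
    ∃ β : ℝ, ∀ a b : ℝ, a + b = q i + q j →
      coeff k (∏ l ∈ s, bernSeries (Function.update (Function.update q i a) j b l)) =
        coeff k (∏ l ∈ s, bernSeries (q l)) + β * (a * b - q i * q j) := by
  set R := ∏ l ∈ (s.erase i).erase j, bernSeries (q l) with hR
  have hj' : j ∈ s.erase i := Finset.mem_erase.2 ⟨hij.symm, hj⟩
  have hprod : ∀ f : ι → ℝ, ∏ l ∈ s, bernSeries (f l) =
      bernSeries (f i) * (bernSeries (f j) * ∏ l ∈ (s.erase i).erase j, bernSeries (f l)) := by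
    intro f
    rw [Finset.mul_prod_erase _ (fun l => bernSeries (f l)) hj',
      Finset.mul_prod_erase _ (fun l => bernSeries (f l)) hi]
  refine ⟨coeff k ((X - 1) ^ 2 * R), fun a b hab => ?_⟩
  have hR' : ∏ l ∈ (s.erase i).erase j,
      bernSeries (Function.update (Function.update q i a) j b l) = R := by
    refine Finset.prod_congr rfl fun l hl => ?_
    simp only [Finset.mem_erase] at hl
    rw [Function.update_of_ne hl.1, Function.update_of_ne hl.2.1]
  rw [hprod, hprod q, hR', ← hR, Function.update_self, Function.update_of_ne hij,
    Function.update_self, mul_comm (coeff k _) (_ - _), ← coeff_C_mul, ← map_add]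
  congr 1
  have hC : (C a : PowerSeries ℝ) = C (q i) + C (q j) - C b := by
    rw [← map_add, ← map_sub, ← hab]
    congr 1
    ring
  simp only [bernSeries_eq, map_sub, map_mul, hC]
  ring

theorem sum_update_update [DecidableEq ι] (s : Finset ι) (q : ι → ℝ) (φ : ℝ → ℝ) {i j : ι}
    (hi : i ∈ s) (hj : j ∈ s) (hij : i ≠ j) (a b : ℝ) :
    ∑ l ∈ s, φ (Function.update (Function.update q i a) j b l) =
      ∑ l ∈ s, φ (q l) + (φ a - φ (q i)) + (φ b - φ (q j)) := by
  have hj' : j ∈ s.erase i := Finset.mem_erase.2 ⟨hij.symm, hj⟩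
  have hsum : ∀ f : ι → ℝ, ∑ l ∈ s, φ (f l) =
      φ (f i) + (φ (f j) + ∑ l ∈ (s.erase i).erase j, φ (f l)) := by
    intro f
    rw [Finset.add_sum_erase _ (fun l => φ (f l)) hj',
      Finset.add_sum_erase _ (fun l => φ (f l)) hi]
  have hrest : ∑ l ∈ (s.erase i).erase j, φ (Function.update (Function.update q i a) j b l) =
      ∑ l ∈ (s.erase i).erase j, φ (q l) := by
    refine Finset.sum_congr rfl fun l hl => ?_
    simp only [Finset.mem_erase] at hl
    rw [Function.update_of_ne hl.1, Function.update_of_ne hl.2.1]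
  rw [hsum, hsum q, hrest, Function.update_self, Function.update_of_ne hij, Function.update_self]
  ring

/-- Hoeffding: under the constraints `0 ≤ q i ≤ P` with a prescribed sum, each point probability
of a sum of independent Bernoulli variables is maximal at a vector whose entries in the open
interval `(0, P)` are all equal. -/
theorem exists_extremal_coeff_prod_bernSeries [Finite ι] (s : Finset ι) (k : ℕ) {P : ℝ}
    {p : ι → ℝ} (hp : ∀ i, p i ∈ Set.Icc 0 P) :
    ∃ q : ι → ℝ, (∀ i, q i ∈ Set.Icc 0 P) ∧ ∑ i ∈ s, q i = ∑ i ∈ s, p i ∧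
      coeff k (∏ i ∈ s, bernSeries (p i)) ≤ coeff k (∏ i ∈ s, bernSeries (q i)) ∧
      ∀ i ∈ s, ∀ j ∈ s, q i ∈ Set.Ioo 0 P → q j ∈ Set.Ioo 0 P → q i = q j := by
  classical
  set F : (ι → ℝ) → ℝ := fun q => coeff k (∏ i ∈ s, bernSeries (q i)) with hF
  have hFc : Continuous F := continuous_coeff_prod_bernSeries s k
  set K : Set (ι → ℝ) := Set.univ.pi (fun _ => Set.Icc 0 P) ∩ {q | ∑ i ∈ s, q i = ∑ i ∈ s, p i}
    with hK
  have hKc : IsCompact K :=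
    (isCompact_univ_pi fun _ => isCompact_Icc).inter_right
      (isClosed_eq (by fun_prop) continuous_const)
  obtain ⟨m, hmK, hm⟩ := hKc.exists_isMaxOn ⟨p, fun i _ => hp i, rfl⟩ hFc.continuousOn
  have hK'c : IsCompact (K ∩ {q | F q = F m}) :=
    hKc.inter_right (isClosed_eq hFc continuous_const)
  obtain ⟨q, ⟨hqK, hqm⟩, hq⟩ := hK'c.exists_isMinOn ⟨m, hmK, rfl⟩
    (f := fun q => ∑ i ∈ s, q i ^ 2) (by fun_prop)
  have hmax : ∀ r ∈ K, F r ≤ F q := fun r hr => by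
    rw [show F q = F m from hqm]
    exact hm hr
  refine ⟨q, fun i => hqK.1 i trivial, hqK.2, hmax p ⟨fun i _ => hp i, rfl⟩, ?_⟩
  have key : ∀ i ∈ s, ∀ j ∈ s, q i ∈ Set.Ioo 0 P → q j ∈ Set.Ioo 0 P → ¬ q i < q j := by
    intro i hi j hj hqi hqj hlt
    have hij : i ≠ j := fun h => hlt.ne (by rw [h])
    obtain ⟨β, hβ⟩ := exists_coeff_prod_bernSeries_update s k q hi hj hij
    have hmem : ∀ a b : ℝ, a ∈ Set.Icc 0 P → b ∈ Set.Icc 0 P → a + b = q i + q j →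
        Function.update (Function.update q i a) j b ∈ K := by
      intro a b ha hb hab
      refine ⟨fun l _ => ?_, ?_⟩
      · rcases eq_or_ne l j with rfl | hlj
        · rwa [Function.update_self]
        rw [Function.update_of_ne hlj]
        rcases eq_or_ne l i with rfl | hli
        · rwa [Function.update_self]
        rw [Function.update_of_ne hli]
        exact hqK.1 l trivial
      · have := sum_update_update s q id hi hj hij a b
        simp only [id] at this
        rw [Set.mem_ofPred_eq, this, ← show ∑ i ∈ s, q i = ∑ i ∈ s, p i from hqK.2]
        linarith
    rcases le_or_gt 0 β with hβ0 | hβ0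
    · set c := (q i + q j) / 2 with hc
      have hcI : c ∈ Set.Icc 0 P :=
        ⟨by linarith [hqi.1, hqj.1], by linarith [hqi.2, hqj.2]⟩
      have hcK := hmem c c hcI hcI (by ring)
      have hFc' := hβ c c (by ring)
      have hcc : c * c - q i * q j = ((q j - q i) / 2) ^ 2 := by
        rw [hc]
        ring
      have hpos : 0 < c * c - q i * q j := hcc ▸ sq_pos_of_pos (by linarith)
      have hge : F q ≤ F (Function.update (Function.update q i c) j c) := by
        simp only [hF]
        rw [hFc']
        nlinarith [mul_nonneg hβ0 hpos.le]
      have hmin := hq (show Function.update (Function.update q i c) j c ∈ K ∩ {q | F q = F m} from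
        ⟨hcK, ((hmax _ hcK).antisymm hge).trans hqm⟩)
      have hsq := sum_update_update s q (fun x => x ^ 2) hi hj hij c c
      simp only [Set.mem_ofPred_eq] at hmin
      rw [hsq] at hmin
      have hcs : c * (q i + q j) = 2 * (c * c) := by
        rw [hc]
        ring
      nlinarith
    · set ε := min (q i) (P - q j) with hε
      have hε0 : 0 < ε := lt_min hqi.1 (by linarith [hqj.2])
      have hεi : ε ≤ q i := min_le_left _ _
      have hεj : ε ≤ P - q j := min_le_right _ _
      have hsum : q i - ε + (q j + ε) = q i + q j := by ring
      have hK' := hmax _ (hmem (q i - ε) (q j + ε) ⟨by linarith, by linarith [hqi.2]⟩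
        ⟨by linarith [hqj.1], by linarith⟩ hsum)
      simp only [hF] at hK'
      rw [hβ _ _ hsum] at hK'
      have : 0 < β * ((q i - ε) * (q j + ε) - q i * q j) :=
        mul_pos_of_neg_of_neg hβ0 (by nlinarith)
      linarith
  intro i hi j hj hqi hqj
  exact le_antisymm (not_lt.1 (key j hj i hi hqj hqi)) (not_lt.1 (key i hi j hj hqi hqj))

theorem prod_bernSeries_le_of_eq_zero_or_eq {s : Finset ι} {q : ι → ℝ} {a P : ℝ} (ha : 0 ≤ a)
    (haP : a ≤ P) (hP : P < 1) (h : ∀ i ∈ s, q i = 0 ∨ q i = a) :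
    CoeffLE (∏ i ∈ s, bernSeries (q i)) (C (1 - P)⁻¹ * poiSeries (∑ i ∈ s, q i)) := by
  have hsplit : ∀ i ∈ s, i ∉ s.filter (fun i => q i ≠ 0) → q i = 0 := fun i hi hi' => by
    by_contra h0
    exact hi' (Finset.mem_filter.2 ⟨hi, h0⟩)
  have hval : ∀ i ∈ s.filter (fun i => q i ≠ 0), q i = a := fun i hi =>
    ((h i (Finset.mem_filter.1 hi).1).resolve_left (Finset.mem_filter.1 hi).2)
  rw [← Finset.prod_subset (Finset.filter_subset (fun i => q i ≠ 0) s)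
      (fun i hi hi' => by rw [hsplit i hi hi', bernSeries_zero]),
    ← Finset.sum_subset (Finset.filter_subset (fun i => q i ≠ 0) s) hsplit,
    Finset.prod_congr rfl (fun i hi => by rw [hval i hi]), Finset.sum_congr rfl hval,
    Finset.prod_const, Finset.sum_const, nsmul_eq_mul]
  refine (bernSeries_pow_le ha (haP.trans_lt hP) _).trans (CoeffLE.C_mul_right ?_
    (poiSeries_nonneg (by positivity)))
  have : 0 < 1 - P := by linarith
  gcongr

/-- The ratio of the point probabilities of a sum of independent Bernoulli variables with success
probabilities at most `P` to those of the Poisson distribution with the same mean is at most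
`(1 - P)⁻²`. -/
theorem prod_bernSeries_le [Finite ι] (s : Finset ι) {P : ℝ} (hP0 : 0 ≤ P) (hP : P < 1) {p : ι → ℝ}
    (hp : ∀ i, p i ∈ Set.Icc 0 P) :
    CoeffLE (∏ i ∈ s, bernSeries (p i))
      (C ((1 - P) ^ 2)⁻¹ * poiSeries (∑ i ∈ s, p i)) := by
  classical
  intro k
  obtain ⟨q, hq, hsum, hle, hext⟩ := exists_extremal_coeff_prod_bernSeries s k hp
  refine hle.trans ?_
  rw [← hsum]
  obtain ⟨a, ha0, haP, ha⟩ : ∃ a, 0 ≤ a ∧ a ≤ P ∧ ∀ i ∈ s.filter (fun i => q i ≠ P),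
      q i = 0 ∨ q i = a := by
    by_cases h : ∃ i ∈ s, q i ∈ Set.Ioo 0 P
    · obtain ⟨i, hi, hqi⟩ := h
      refine ⟨q i, hqi.1.le, hqi.2.le, fun j hj => ?_⟩
      rw [Finset.mem_filter] at hj
      rcases (hq j).1.eq_or_lt with h0 | h0
      · exact Or.inl h0.symm
      · exact Or.inr (hext j hj.1 i hi ⟨h0, lt_of_le_of_ne (hq j).2 hj.2⟩ hqi)
    · refine ⟨0, le_rfl, hP0, fun j hj => Or.inl ?_⟩
      rw [Finset.mem_filter] at hj
      by_contra h0
      exact h ⟨j, hj.1, lt_of_le_of_ne (hq j).1 (Ne.symm h0), lt_of_le_of_ne (hq j).2 hj.2⟩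
  have h1 := prod_bernSeries_le_of_eq_zero_or_eq hP0 le_rfl hP
    (s := s.filter fun i => q i = P) (q := q) fun i hi => Or.inr (Finset.mem_filter.1 hi).2
  have h2 := prod_bernSeries_le_of_eq_zero_or_eq ha0 haP hP ha
  have hmul := CoeffLE.mul
    (CoeffLE.prod_nonneg fun i _ => bernSeries_nonneg (hq i).1 ((hq i).2.trans hP.le))
    (CoeffLE.C_mul_nonneg (inv_nonneg.2 (by linarith))
      (poiSeries_nonneg (Finset.sum_nonneg fun i _ => (hq i).1))) h1 h2
  rw [Finset.prod_filter_mul_prod_filter_not] at hmul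
  refine (hmul k).trans_eq ?_
  rw [← Finset.sum_filter_add_sum_filter_not s (fun i => q i = P) q, poiSeries_add, sq, mul_inv,
    map_mul C]
  exact congrArg _ (mul_mul_mul_comm _ _ _ _)

end Extremal

section Remainder

open PowerSeries

/-- The coefficient of index `l` is the mean excess `E[(Y - 1 - l)⁺]` of a Poisson(`p`)
variable `Y`. -/
noncomputable def poiRemainder (p : ℝ) : PowerSeries ℝ :=
  PowerSeries.mk fun l => ∑' m : ℕ, (m + 1 : ℝ) * poiPMF p (l + 2 + m)

theorem coeff_poiRemainder (p : ℝ) (l : ℕ) :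
    coeff l (poiRemainder p) = ∑' m : ℕ, (m + 1 : ℝ) * poiPMF p (l + 2 + m) := coeff_mk _ _

theorem summable_poiPMF_add (p : ℝ) (l : ℕ) : Summable fun m => poiPMF p (l + m) := by
  simpa only [add_comm l] using (summable_nat_add_iff l).2 (hasSum_poiPMF p).summable

theorem summable_succ_mul_poiPMF_add (p : ℝ) (l : ℕ) :
    Summable fun m : ℕ => (m + 1 : ℝ) * poiPMF p (l + m) := by
  have h := (summable_nat_add_iff l).2 (hasSum_nat_mul_poiPMF p).summable
  have h' := h.add ((summable_poiPMF_add p l).mul_left (1 - l : ℝ))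
  refine h'.congr fun m => ?_
  rw [add_comm m l]
  push_cast
  ring

theorem poiRemainder_nonneg {p : ℝ} (hp : 0 ≤ p) : CoeffLE 0 (poiRemainder p) := fun l => by
  rw [coeff_poiRemainder, map_zero]
  exact tsum_nonneg fun m => mul_nonneg (by positivity) (poiPMF_nonneg hp _)

theorem poiRemainder_le {p : ℝ} (hp : 0 ≤ p) :
    CoeffLE (poiRemainder p) (C (p ^ 2 / 2 * Real.exp p) * poiSeries p) := fun l => by
  rw [coeff_poiRemainder, coeff_C_mul, coeff_poiSeries]
  have hs := (hasSum_poiPMF p).mul_left (p ^ 2 / 2 * Real.exp p * poiPMF p l)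
  rw [mul_one] at hs
  refine (summable_succ_mul_poiPMF_add p (l + 2)).tsum_le_of_sum_le fun s => ?_
  refine (Finset.sum_le_sum fun m _ => ?_).trans
    (sum_le_hasSum s (fun m _ => mul_nonneg (mul_nonneg (by positivity) (poiPMF_nonneg hp l))
      (poiPMF_nonneg hp m)) hs)
  have hfac : ((m + 1) * 2 * l.factorial * m.factorial : ℝ) ≤ (l + 2 + m).factorial := by
    have h1 := Nat.le_of_dvd (Nat.factorial_pos _)
      (Nat.factorial_mul_factorial_dvd_factorial_add l (m + 2))
    have h2 : (m + 1) * 2 * m.factorial ≤ (m + 2).factorial := by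
      rw [Nat.factorial_succ, Nat.factorial_succ]
      nlinarith [Nat.zero_le (m * ((m + 1) * m.factorial))]
    have h3 : (m + 1) * 2 * l.factorial * m.factorial ≤ (l + 2 + m).factorial := by
      calc _ = l.factorial * ((m + 1) * 2 * m.factorial) := by ring
        _ ≤ l.factorial * (m + 2).factorial := by gcongr
        _ ≤ _ := by rwa [show l + 2 + m = l + (m + 2) by ring]
    exact_mod_cast h3
  unfold poiPMF
  rw [mul_div_assoc', div_le_iff₀ (by positivity)]
  calc _ = Real.exp (-p) * p ^ (l + 2 + m) / (2 * l.factorial * m.factorial) *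
        ((m + 1) * 2 * l.factorial * m.factorial) := by field_simp
    _ ≤ Real.exp (-p) * p ^ (l + 2 + m) / (2 * l.factorial * m.factorial) *
        (l + 2 + m).factorial := by gcongr
    _ = _ := by
      rw [Real.exp_neg, pow_add, pow_add]
      field_simp

theorem tsum_poiPMF_add_sub (p : ℝ) (l : ℕ) :
    ∑' m, poiPMF p (l + m) - ∑' m, poiPMF p (l + 1 + m) = poiPMF p l := by
  rw [(summable_poiPMF_add p l).tsum_eq_zero_add]
  rw [add_zero, add_sub_assoc, tsum_congr fun m => by rw [← add_assoc l m 1, add_right_comm],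
    sub_self, add_zero]

theorem coeff_poiRemainder_sub (p : ℝ) (l : ℕ) :
    coeff l (poiRemainder p) - coeff (l + 1) (poiRemainder p) = ∑' m, poiPMF p (l + 2 + m) := by
  rw [coeff_poiRemainder, coeff_poiRemainder,
    (summable_succ_mul_poiPMF_add p (l + 2)).tsum_eq_zero_add, add_sub_assoc,
    ← Summable.tsum_sub _ (summable_succ_mul_poiPMF_add p (l + 1 + 2)),
    (summable_poiPMF_add p (l + 2)).tsum_eq_zero_add]
  · congr 1
    · simp
    · refine tsum_congr fun m => ?_
      rw [show l + 2 + (m + 1) = l + 1 + 2 + m by ring]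
      push_cast
      ring
  · exact (summable_nat_add_iff 1).2 (summable_succ_mul_poiPMF_add p (l + 2))

theorem coeff_zero_poiRemainder (p : ℝ) :
    coeff 0 (poiRemainder p) = p - 1 + poiPMF p 0 := by
  have h := (hasSum_nat_add_iff' 2).2 ((hasSum_nat_mul_poiPMF p).sub (hasSum_poiPMF p))
  rw [coeff_poiRemainder]
  have h' : (fun m : ℕ => (m + 1 : ℝ) * poiPMF p (0 + 2 + m)) =
      fun m : ℕ => ((m + 2 : ℕ) : ℝ) * poiPMF p (m + 2) - poiPMF p (m + 2) := by
    funext m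
    rw [show 0 + 2 + m = m + 2 by ring]
    push_cast
    ring
  rw [h', h.tsum_eq]
  simp [Finset.sum_range_succ]

theorem one_sub_X_sq_mul_poiRemainder (p : ℝ) :
    (1 - X) * ((1 - X) * poiRemainder p) = poiSeries p - bernSeries p := by
  have h0 := coeff_zero_poiRemainder p
  have htot : ∑' m, poiPMF p (0 + m) = 1 := by simpa using (hasSum_poiPMF p).tsum_eq
  have hA := tsum_poiPMF_add_sub p 0
  have hB := tsum_poiPMF_add_sub p 1
  have hC := coeff_poiRemainder_sub p 0
  simp only [bernSeries]
  ext k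
  simp only [sub_mul, one_mul, mul_sub, map_sub, map_add, coeff_C_mul, coeff_poiSeries]
  rcases k with _ | _ | k
  · simp only [coeff_zero_X_mul, coeff_zero_X, coeff_zero_C]
    linarith
  · simp only [zero_add, Nat.reduceAdd] at hA hB hC htot
    simp only [coeff_succ_X_mul, coeff_zero_X_mul, coeff_C, zero_add, coeff_one_X, one_ne_zero,
      if_false]
    linarith
  · have hD := coeff_poiRemainder_sub p k
    have hE := coeff_poiRemainder_sub p (k + 1)
    have hF := tsum_poiPMF_add_sub p (k + 2)
    rw [show k + 1 + 2 = k + 2 + 1 by ring] at hE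
    simp only [coeff_succ_X_mul, coeff_C, coeff_X, Nat.add_eq_zero_iff, one_ne_zero, and_false,
      add_eq_right, if_false]
    linarith

end Remainder

section Pairing

open PowerSeries

theorem tsum_coeff_one_sub_X_mul {e : PowerSeries ℝ} {h : ℕ → ℝ}
    (h0 : Summable fun k => coeff k e * h k) (h1 : Summable fun k => coeff k e * h (k + 1)) :
    (Summable fun k => coeff k ((1 - X) * e) * h k) ∧
      ∑' k, coeff k ((1 - X) * e) * h k = -∑' k, coeff k e * (h (k + 1) - h k) := by
  have hX : HasSum (fun k => coeff k (X * e) * h k) (∑' k, coeff k e * h (k + 1)) := by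
    rw [← hasSum_nat_add_iff' 1]
    simpa only [coeff_succ_X_mul, Finset.range_one, Finset.sum_singleton, coeff_zero_X_mul,
      zero_mul, sub_zero] using h1.hasSum
  have hsub := h0.hasSum.sub hX
  have heq : (fun k => coeff k e * h k - coeff k (X * e) * h k) =
      fun k => coeff k ((1 - X) * e) * h k := by
    funext k
    rw [sub_mul, one_mul, map_sub]
    ring
  rw [heq] at hsub
  refine ⟨hsub.summable, ?_⟩
  simp only [hsub.tsum_eq, mul_sub, h1.tsum_sub h0]
  ring

theorem tsum_coeff_one_sub_X_sq_mul {e : PowerSeries ℝ} {h : ℕ → ℝ}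
    (h0 : Summable fun k => coeff k e * h k) (h1 : Summable fun k => coeff k e * h (k + 1))
    (h2 : Summable fun k => coeff k e * h (k + 2)) :
    ∑' k, coeff k ((1 - X) * ((1 - X) * e)) * h k =
      ∑' k, coeff k e * (h (k + 2) - 2 * h (k + 1) + h k) := by
  have A := tsum_coeff_one_sub_X_mul h0 h1
  have B := tsum_coeff_one_sub_X_mul (h := fun k => h (k + 1)) h1 h2
  have D := tsum_coeff_one_sub_X_mul (h := fun k => h (k + 1) - h k)
    (by simpa only [mul_sub] using h1.sub h0) (by simpa only [mul_sub] using h2.sub h1)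
  rw [(tsum_coeff_one_sub_X_mul A.1 B.1).2, D.2, neg_neg]
  refine tsum_congr fun k => ?_
  ring

/-- A sequence is absolutely summable against the Poisson weights as soon as its increments
are. -/
theorem summable_mul_poiPMF_of_diff {x : ℝ} (hx : 0 ≤ x) {f : ℕ → ℝ}
    (hf : Summable fun k => |f (k + 1) - f k| * poiPMF x k) :
    Summable fun k => |f k| * poiPMF x k := by
  set a : ℕ → ℝ := fun k => |f (k + 1) - f k| * poiPMF x k with ha
  have ha0 : ∀ k, 0 ≤ a k := fun k => mul_nonneg (abs_nonneg _) (poiPMF_nonneg hx k)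
  have hb := Real.summable_pow_div_factorial x
  have hb0 : ∀ k : ℕ, 0 ≤ x ^ k / k.factorial := fun k => by positivity
  have hconv := summable_norm_sum_mul_antidiagonal_of_summable_norm
    (f := a) (g := fun k => x ^ k / k.factorial) hf.norm hb.norm
  have hbound := hconv.add ((hasSum_poiPMF x).summable.mul_left |f 0|)
  refine Summable.of_nonneg_of_le
    (fun k => mul_nonneg (abs_nonneg _) (poiPMF_nonneg hx k)) (fun k => ?_) hbound
  have htri : |f k| ≤ ∑ j ∈ Finset.range k, |f (j + 1) - f j| + |f 0| := by
    have h1 := Finset.sum_range_sub f k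
    have h2 : |f k - f 0| ≤ ∑ j ∈ Finset.range k, |f (j + 1) - f j| :=
      h1 ▸ Finset.abs_sum_le_sum_abs _ _
    linarith [abs_sub_abs_le_abs_sub (f k) (f 0)]
  refine (mul_le_mul_of_nonneg_right htri (poiPMF_nonneg hx k)).trans ?_
  rw [add_mul]
  refine add_le_add ((le_trans ?_ (le_abs_self _)).trans_eq (Real.norm_eq_abs _).symm) le_rfl
  rw [Finset.Nat.sum_antidiagonal_eq_sum_range_succ_mk, Finset.sum_mul]
  refine (Finset.sum_le_sum fun j hj => ?_).trans
    (Finset.sum_le_sum_of_subset_of_nonneg (Finset.range_subset_range.2 (Nat.le_succ k))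
      fun j _ _ => mul_nonneg (ha0 j) (hb0 _))
  rw [Finset.mem_range] at hj
  simp only [ha]
  rw [mul_assoc]
  refine mul_le_mul_of_nonneg_left ?_ (abs_nonneg _)
  have hfac : (j.factorial * (k - j).factorial : ℝ) ≤ k.factorial := by
    have := Nat.le_of_dvd (Nat.factorial_pos _)
      (Nat.factorial_mul_factorial_dvd_factorial_add j (k - j))
    rw [Nat.add_sub_cancel' hj.le] at this
    exact_mod_cast this
  unfold poiPMF
  rw [div_mul_div_comm, mul_assoc, ← pow_add, Nat.add_sub_cancel' hj.le]
  gcongr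

theorem summable_coeff_mul {e : PowerSeries ℝ} {c x : ℝ} (he : CoeffLE 0 e)
    (hle : CoeffLE e (C c * poiSeries x)) {f : ℕ → ℝ}
    (hf : Summable fun k => |f k| * poiPMF x k) : Summable fun k => coeff k e * f k := by
  refine Summable.of_norm_bounded (hf.mul_left c) fun k => ?_
  have h0 : 0 ≤ coeff k e := by simpa using he k
  have h1 : coeff k e ≤ c * poiPMF x k := by simpa [coeff_C_mul] using hle k
  rw [norm_mul, Real.norm_of_nonneg h0, Real.norm_eq_abs]
  calc _ ≤ c * poiPMF x k * |f k| := mul_le_mul_of_nonneg_right h1 (abs_nonneg _)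
    _ = _ := by ring

theorem abs_tsum_coeff_mul_le {e : PowerSeries ℝ} {c x : ℝ} (he : CoeffLE 0 e)
    (hle : CoeffLE e (C c * poiSeries x)) {f : ℕ → ℝ}
    (hf : Summable fun k => |f k| * poiPMF x k) :
    |∑' k, coeff k e * f k| ≤ c * ∑' k, |f k| * poiPMF x k := by
  rw [← Real.norm_eq_abs]
  refine tsum_of_norm_bounded (hf.hasSum.mul_left c) fun k => ?_
  have h0 : 0 ≤ coeff k e := by simpa using he k
  have h1 : coeff k e ≤ c * poiPMF x k := by simpa [coeff_C_mul] using hle k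
  rw [norm_mul, Real.norm_of_nonneg h0, Real.norm_eq_abs]
  calc _ ≤ c * poiPMF x k * |f k| := mul_le_mul_of_nonneg_right h1 (abs_nonneg _)
    _ = _ := by ring

end Pairing

section Lindeberg

open PowerSeries

theorem abs_tsum_bernSeries_sub_poiSeries_le {U : PowerSeries ℝ} {p c x : ℝ} {h : ℕ → ℝ}
    (hU : CoeffLE 0 U) (hp : 0 ≤ p) (hx : 0 ≤ x)
    (hUp : CoeffLE (U * poiSeries p) (C c * poiSeries x))
    (hdiff : Summable fun k => |h (k + 2) - 2 * h (k + 1) + h k| * poiPMF x k)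
    (hbern : Summable fun k => coeff k (U * bernSeries p) * h k) :
    |∑' k, coeff k (U * bernSeries p) * h k - ∑' k, coeff k (U * poiSeries p) * h k| ≤
      p ^ 2 / 2 * Real.exp p * c *
        ∑' k, |h (k + 2) - 2 * h (k + 1) + h k| * poiPMF x k := by
  have hd1 : Summable fun k => |h (k + 1) - h k| * poiPMF x k := by
    refine summable_mul_poiPMF_of_diff hx (f := fun k => h (k + 1) - h k) (hdiff.congr fun k => ?_)
    congr 2
    ring
  have hd0 := summable_mul_poiPMF_of_diff hx hd1
  have he : CoeffLE 0 (U * poiRemainder p) := hU.mul_nonneg (poiRemainder_nonneg hp)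
  have hle : CoeffLE (U * poiRemainder p) (C (p ^ 2 / 2 * Real.exp p * c) * poiSeries x) := by
    have h1 := hU.mul_left (poiRemainder_le hp)
    have h2 := hUp.C_mul_left (c := p ^ 2 / 2 * Real.exp p) (by positivity)
    rw [mul_left_comm] at h1
    rw [← mul_assoc (C _) (C c), ← map_mul] at h2
    exact h1.trans h2
  have s0 := summable_coeff_mul he hle hd0
  have s1 : Summable fun k => coeff k (U * poiRemainder p) * h (k + 1) := by
    refine (s0.add (summable_coeff_mul he hle hd1)).congr fun k => ?_
    ring
  have s2 : Summable fun k => coeff k (U * poiRemainder p) * h (k + 2) := by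
    refine ((s1.mul_left 2).sub s0 |>.add (summable_coeff_mul he hle hdiff)).congr fun k => ?_
    ring
  have hpoi : Summable fun k => coeff k (U * poiSeries p) * h k :=
    summable_coeff_mul (hU.mul_nonneg (poiSeries_nonneg hp)) hUp hd0
  have heq : (1 - X) * ((1 - X) * (U * poiRemainder p)) = U * poiSeries p - U * bernSeries p := by
    rw [← mul_sub, ← one_sub_X_sq_mul_poiRemainder]
    ring
  have hsum := tsum_coeff_one_sub_X_sq_mul s0 s1 s2
  rw [heq] at hsum
  simp only [map_sub, sub_mul] at hsum
  rw [hpoi.tsum_sub hbern] at hsum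
  rw [abs_sub_comm, hsum]
  exact abs_tsum_coeff_mul_le he hle hdiff

theorem abs_tsum_prod_bernSeries_sub_le {ι : Type*} [Fintype ι] [DecidableEq ι] {p : ι → ℝ}
    {P : ℝ} (hP0 : 0 ≤ P) (hP : P < 1) (hp : ∀ i, p i ∈ Set.Icc 0 P) {h : ℕ → ℝ}
    (hdiff : Summable fun k => |h (k + 2) - 2 * h (k + 1) + h k| * poiPMF (∑ i, p i) k)
    (s : Finset ι) :
    |∑' k, coeff k ((∏ i ∈ s, bernSeries (p i)) * poiSeries (∑ i ∈ sᶜ, p i)) * h k -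
        ∑' k, h k * poiPMF (∑ i, p i) k| ≤
      ∑ i ∈ s, p i ^ 2 / 2 * Real.exp (p i) * ((1 - P) ^ 2)⁻¹ *
        ∑' k, |h (k + 2) - 2 * h (k + 1) + h k| * poiPMF (∑ i, p i) k := by
  have hx : 0 ≤ ∑ i, p i := Finset.sum_nonneg fun i _ => (hp i).1
  have hnonneg : ∀ t : Finset ι, CoeffLE 0 (∏ i ∈ t, bernSeries (p i)) := fun t =>
    CoeffLE.prod_nonneg fun i _ => bernSeries_nonneg (hp i).1 ((hp i).2.trans hP.le)
  have hpoi : ∀ t : Finset ι, CoeffLE 0 (poiSeries (∑ i ∈ t, p i)) := fun t =>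
    poiSeries_nonneg (Finset.sum_nonneg fun i _ => (hp i).1)
  have hdom : ∀ t : Finset ι, CoeffLE ((∏ i ∈ t, bernSeries (p i)) * poiSeries (∑ i ∈ tᶜ, p i))
      (C ((1 - P) ^ 2)⁻¹ * poiSeries (∑ i, p i)) := fun t => by
    rw [← Finset.sum_add_sum_compl t p, poiSeries_add, ← mul_assoc, mul_comm (∏ i ∈ t, _),
      mul_comm (C _ * _)]
    exact (hpoi _).mul_left (prod_bernSeries_le t hP0 hP hp)
  induction s using Finset.induction_on with
  | empty => simp [mul_comm]
  | insert i s hi ih =>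
    rw [Finset.sum_insert hi]
    refine (abs_sub_le _ _ _).trans (add_le_add ?_ ih)
    have hcompl : ∑ j ∈ sᶜ, p j = ∑ j ∈ (insert i s)ᶜ, p j + p i := by
      rw [Finset.compl_insert, Finset.sum_erase_add _ _ (Finset.mem_compl.2 hi)]
    have hb : (∏ j ∈ insert i s, bernSeries (p j)) * poiSeries (∑ j ∈ (insert i s)ᶜ, p j) =
        (∏ j ∈ s, bernSeries (p j)) * poiSeries (∑ j ∈ (insert i s)ᶜ, p j) *
          bernSeries (p i) := by
      rw [Finset.prod_insert hi]
      ring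
    have hc := hdom s
    rw [hcompl, poiSeries_add, ← mul_assoc] at hc ⊢
    have hbs : Summable fun k => coeff k ((∏ j ∈ insert i s, bernSeries (p j)) *
        poiSeries (∑ j ∈ (insert i s)ᶜ, p j)) * h k := by
      refine summable_coeff_mul ((hnonneg _).mul_nonneg (hpoi _)) (hdom _)
        (summable_mul_poiPMF_of_diff hx (summable_mul_poiPMF_of_diff hx
          (f := fun k => h (k + 1) - h k) (hdiff.congr fun k => ?_)))
      congr 2
      ring
    rw [hb] at hbs ⊢
    exact abs_tsum_bernSeries_sub_poiSeries_le ((hnonneg s).mul_nonneg (hpoi _)) (hp i).1 hx hc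
      hdiff hbs

end Lindeberg

section Outcomes

open PowerSeries

theorem prod_bernSeries_eq_sum {n : ℕ} (p : Fin n → ℝ) :
    ∏ i, bernSeries (p i) = ∑ u : Fin n → Bool, C (bernProb p u) * X ^ countOnes u := by
  have h : ∀ i, bernSeries (p i) =
      ∑ b : Bool, C (if b then p i else 1 - p i) * X ^ (if b then 1 else 0) := fun i => by
    simp [bernSeries, add_comm]
  simp only [h, Finset.prod_univ_sum, Fintype.piFinset_univ, Finset.prod_mul_distrib,
    Finset.prod_pow_eq_pow_sum, bernProb, countOnes, map_prod]

theorem sum_bernProb_mul {n : ℕ} (p : Fin n → ℝ) (h : ℕ → ℝ) :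
    ∑ u : Fin n → Bool, bernProb p u * h (countOnes u) =
      ∑' k, coeff k (∏ i, bernSeries (p i)) * h k := by
  refine (HasSum.tsum_eq ?_).symm
  simp only [prod_bernSeries_eq_sum, map_sum, Finset.sum_mul]
  refine hasSum_sum fun u _ => ?_
  have := hasSum_ite_eq (countOnes u) (bernProb p u * h (countOnes u))
  refine this.congr_fun fun k => ?_
  simp only [coeff_C_mul, coeff_X_pow]
  split_ifs with hk <;> simp [hk]

end Outcomes


/-- Borisov–Ruzankin bound: for `S` a sum of independent Bernoulli(`p i`) variables,
`x = ∑ p i`, `p = max_i p i < 1`, and `X ~ Poisson(x)`, if `E[|Δ²h(X)|] ≤ ν < ∞` then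
`|E[h(S)] - E[h(X)]| ≤ (x ν / 2) · p e^p / (1 - p)²`. -/
theorem stmt8 {n : ℕ} (hn : 0 < n) (p : Fin n → ℝ) (hp : ∀ i, 0 < p i ∧ p i < 1)
    (h : ℕ → ℝ) (ν : ℝ)
    (hsum : Summable fun k => |h (k + 2) - 2 * h (k + 1) + h k| * poiPMF (∑ i, p i) k)
    (hν : ∑' k : ℕ, |h (k + 2) - 2 * h (k + 1) + h k| * poiPMF (∑ i, p i) k ≤ ν) :
    |(∑ u : Fin n → Bool, bernProb p u * h (countOnes u)) -
        ∑' k : ℕ, h k * poiPMF (∑ i, p i) k| ≤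
      (∑ i, p i) * ν / 2 *
        ((Finset.univ.sup' ⟨⟨0, hn⟩, Finset.mem_univ _⟩ p) *
          Real.exp (Finset.univ.sup' ⟨⟨0, hn⟩, Finset.mem_univ _⟩ p) /
            (1 - Finset.univ.sup' ⟨⟨0, hn⟩, Finset.mem_univ _⟩ p) ^ 2) := by
  set P := Finset.univ.sup' ⟨⟨0, hn⟩, Finset.mem_univ _⟩ p with hPdef
  have hle : ∀ i, p i ≤ P := fun i => Finset.le_sup' p (Finset.mem_univ i)
  have hP0 : 0 ≤ P := (hp ⟨0, hn⟩).1.le.trans (hle _)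
  have hP : P < 1 := (Finset.sup'_lt_iff _).2 fun i _ => (hp i).2
  have hmain := abs_tsum_prod_bernSeries_sub_le hP0 hP (fun i => ⟨(hp i).1.le, hle i⟩) hsum
    Finset.univ
  rw [Finset.compl_univ, Finset.sum_empty, poiSeries_zero, mul_one, ← sum_bernProb_mul] at hmain
  refine hmain.trans ?_
  have hT0 : 0 ≤ ∑' k : ℕ, |h (k + 2) - 2 * h (k + 1) + h k| * poiPMF (∑ i, p i) k :=
    tsum_nonneg fun k => mul_nonneg (abs_nonneg _)
      (poiPMF_nonneg (Finset.sum_nonneg fun i _ => (hp i).1.le) k)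
  calc _ ≤ ∑ i, p i * (P / 2 * Real.exp P * ((1 - P) ^ 2)⁻¹ * ν) := by
        refine Finset.sum_le_sum fun i _ => ?_
        have hi := (hp i).1.le
        calc _ = p i * (p i / 2 * Real.exp (p i) * ((1 - P) ^ 2)⁻¹ *
              ∑' k : ℕ, |h (k + 2) - 2 * h (k + 1) + h k| * poiPMF (∑ i, p i) k) := by ring
          _ ≤ _ := by gcongr <;> exact hle i
    _ = _ := by
      rw [← Finset.sum_mul]
      ring
end

section
/- Consider a nonatomic congestion game with costs c_e weakly increasing, differentiable with c_e'(x) ≥ β > 0 on [0, α]. Let (ŷ, x̂) be a Wardrop equilibrium for demands d with d_tot ≤ α and (ŷ', x̂') a Wardrop equilibrium for demands d' with d'_tot ≤ α. Then ‖x̂' - x̂‖₂ ≤ √(2C/β) · √(‖d' - d‖₁), where C = max over feasible strategies s of ∑_{e ∈ s} c_e(α). -/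
open scoped BigOperators Classical

variable {E T : Type*}

/-- A feasible flow-load pair for a nonatomic congestion game with strategy sets `strat` and
demands `d`. -/
def Feasible [Fintype E] [Fintype T] (strat : T → Finset (Finset E)) (d : T → ℝ)
    (y : T → Finset E → ℝ) (x : E → ℝ) : Prop :=
  (∀ t s, 0 ≤ y t s) ∧ (∀ t s, s ∉ strat t → y t s = 0) ∧
  (∀ t, d t = ∑ s ∈ strat t, y t s) ∧
  (∀ e, x e = ∑ t, ∑ s ∈ strat t, if e ∈ s then y t s else 0)

/-- A Wardrop equilibrium: a feasible flow-load pair where only minimum-cost strategies are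
used. -/
def IsWE [Fintype E] [Fintype T] (strat : T → Finset (Finset E)) (c : E → ℝ → ℝ)
    (d : T → ℝ) (y : T → Finset E → ℝ) (x : E → ℝ) : Prop :=
  Feasible strat d y x ∧
  ∀ t, ∀ s ∈ strat t, ∀ s' ∈ strat t, 0 < y t s →
    ∑ e ∈ s, c e (x e) ≤ ∑ e ∈ s', c e (x e)

/-- The total cost of the loads `x` under prices `p` is the flow-weighted cost of the strategies. -/
theorem Feasible.sum_mul_load [Fintype E] [Fintype T] {strat : T → Finset (Finset E)}
    {d : T → ℝ} {y : T → Finset E → ℝ} {x : E → ℝ} (h : Feasible strat d y x) (p : E → ℝ) :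
    ∑ e, p e * x e = ∑ t, ∑ s ∈ strat t, y t s * ∑ e ∈ s, p e := by
  obtain ⟨-, -, -, hx⟩ := h
  simp_rw [hx, Finset.mul_sum]
  rw [Finset.sum_comm]
  refine Finset.sum_congr rfl fun t _ => ?_
  rw [Finset.sum_comm]
  refine Finset.sum_congr rfl fun s _ => ?_
  simp only [mul_ite, mul_zero]
  rw [← Finset.sum_filter, Finset.filter_univ_mem]
  exact Finset.sum_congr rfl fun e _ => mul_comm _ _

theorem Feasible.load_mem_Icc [Fintype E] [Fintype T] {strat : T → Finset (Finset E)}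
    {d : T → ℝ} {y : T → Finset E → ℝ} {x : E → ℝ} (h : Feasible strat d y x) {α : ℝ}
    (hα : ∑ t, d t ≤ α) (e : E) : x e ∈ Set.Icc 0 α := by
  obtain ⟨hy, -, hd, hx⟩ := h
  rw [hx]
  constructor
  · refine Finset.sum_nonneg fun t _ => Finset.sum_nonneg fun s _ => ?_
    split_ifs
    exacts [hy t s, le_rfl]
  · refine le_trans (Finset.sum_le_sum fun t _ => ?_) hα
    rw [hd t]
    refine Finset.sum_le_sum fun s _ => ?_
    split_ifs
    exacts [le_rfl, hy t s]

/-- Pricing a feasible flow by lower bounds on the strategy costs underestimates its cost. -/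
theorem Feasible.sum_mul_demand_le [Fintype E] [Fintype T] {strat : T → Finset (Finset E)}
    {d : T → ℝ} {y : T → Finset E → ℝ} {x : E → ℝ} (h : Feasible strat d y x)
    {p : E → ℝ} {l : T → ℝ} (hl : ∀ t, ∀ s ∈ strat t, l t ≤ ∑ e ∈ s, p e) :
    ∑ t, l t * d t ≤ ∑ e, p e * x e := by
  rw [h.sum_mul_load]
  obtain ⟨hy, -, hd, -⟩ := h
  refine Finset.sum_le_sum fun t _ => ?_
  rw [hd t, Finset.mul_sum]
  refine Finset.sum_le_sum fun s hs => ?_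
  rw [mul_comm]
  exact mul_le_mul_of_nonneg_left (hl t s hs) (hy t s)

/-- The equilibrium costs of the types at a Wardrop equilibrium. -/
theorem IsWE.exists_type_cost [Fintype E] [Fintype T] {strat : T → Finset (Finset E)}
    {c : E → ℝ → ℝ} {d : T → ℝ} {y : T → Finset E → ℝ} {x : E → ℝ} (h : IsWE strat c d y x)
    (hc : ∀ e, 0 ≤ c e (x e)) {C : ℝ} (hC : 0 ≤ C)
    (hle : ∀ t, ∀ s ∈ strat t, ∑ e ∈ s, c e (x e) ≤ C) :
    ∃ l : T → ℝ, (∀ t, l t ∈ Set.Icc 0 C) ∧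
      (∀ t, ∀ s ∈ strat t, l t ≤ ∑ e ∈ s, c e (x e)) ∧
      ∑ e, c e (x e) * x e = ∑ t, l t * d t := by
  have key : ∀ t, ∃ l : ℝ, l ∈ Set.Icc 0 C ∧ (∀ s ∈ strat t, l ≤ ∑ e ∈ s, c e (x e)) ∧
      ∀ s ∈ strat t, 0 < y t s → ∑ e ∈ s, c e (x e) ≤ l := by
    intro t
    rcases (strat t).eq_empty_or_nonempty with he | hn
    · exact ⟨0, ⟨le_rfl, hC⟩, by simp [he], by simp [he]⟩
    · obtain ⟨s, hs, hmin⟩ := (strat t).exists_min_image (fun s => ∑ e ∈ s, c e (x e)) hn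
      exact ⟨_, ⟨Finset.sum_nonneg fun e _ => hc e, hle t s hs⟩, hmin,
        fun s' hs' hy => h.2 t s' hs' s hs hy⟩
  choose l hl hmin hused using key
  refine ⟨l, hl, hmin, ?_⟩
  rw [h.1.sum_mul_load (fun e => c e (x e))]
  obtain ⟨hy, -, hd, -⟩ := h.1
  refine Finset.sum_congr rfl fun t _ => ?_
  rw [hd t, Finset.mul_sum]
  refine Finset.sum_congr rfl fun s hs => ?_
  rcases (hy t s).eq_or_lt with h0 | hpos
  · simp [← h0]
  · rw [le_antisymm (hused t s hs hpos) (hmin t s hs), mul_comm]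

/-- A function whose derivative is at least `β` on an interval is `β`-strongly monotone there. -/
theorem mul_sq_sub_le_of_le_derivWithin_Icc {f : ℝ → ℝ} {α β : ℝ}
    (hf : ∀ z ∈ Set.Icc (0 : ℝ) α, ∃ dz, HasDerivWithinAt f dz (Set.Icc 0 α) z ∧ β ≤ dz)
    {a b : ℝ} (ha : a ∈ Set.Icc 0 α) (hb : b ∈ Set.Icc 0 α) :
    β * (b - a) ^ 2 ≤ (f b - f a) * (b - a) := by
  have hcont : ContinuousOn f (Set.Icc 0 α) := fun z hz => by
    obtain ⟨_, h, -⟩ := hf z hz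
    exact h.continuousWithinAt
  have hder : ∀ z ∈ interior (Set.Icc (0 : ℝ) α), ∃ dz, HasDerivAt f dz z ∧ β ≤ dz :=
    fun z hz => by
      obtain ⟨dz, h, hle⟩ := hf z (interior_subset hz)
      exact ⟨dz, h.hasDerivAt (mem_interior_iff_mem_nhds.1 hz), hle⟩
  have mean : ∀ u ∈ Set.Icc 0 α, ∀ v ∈ Set.Icc 0 α, u ≤ v → β * (v - u) ≤ f v - f u :=
    (convex_Icc 0 α).mul_sub_le_image_sub_of_le_deriv hcont
      (fun z hz => by
        obtain ⟨_, h, -⟩ := hder z hz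
        exact h.differentiableAt.differentiableWithinAt)
      (fun z hz => by
        obtain ⟨_, h, hle⟩ := hder z hz
        rwa [h.deriv])
  rcases le_total a b with hab | hab
  · nlinarith [mean a ha b hb hab]
  · nlinarith [mean b hb a ha hab]

/-- Sensitivity of Wardrop equilibria with respect to the demands: if `(yhat, xhat)` and
`(yhat', xhat')` are Wardrop equilibria for demands `d` and `d'` (both of total at most `α`)
in a game with weakly increasing differentiable costs with `c_e' ≥ β > 0` on `[0, α]`, then
`‖xhat' - xhat‖₂ ≤ √(2 C / β) · √(‖d' - d‖₁)` where `C` is the largest cost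
`∑_{e ∈ s} c_e(α)` over feasible strategies `s`. -/
theorem stmt10 [Fintype E] [Fintype T]
    (strat : T → Finset (Finset E))
    (hne : (Finset.univ.biUnion strat : Finset (Finset E)).Nonempty)
    (c : E → ℝ → ℝ) (d d' : T → ℝ)
    (α β : ℝ) (hβ : 0 < β)
    (hcpos : ∀ e z, 0 ≤ z → 0 ≤ c e z)
    (hd : ∀ t, 0 ≤ d t) (hd' : ∀ t, 0 ≤ d' t)
    (hdtot : ∑ t, d t ≤ α) (hdtot' : ∑ t, d' t ≤ α)
    (hmono : ∀ e, MonotoneOn (c e) (Set.Icc 0 α))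
    (hderiv : ∀ e, ∀ z ∈ Set.Icc (0 : ℝ) α,
      ∃ dz, HasDerivWithinAt (c e) dz (Set.Icc 0 α) z ∧ β ≤ dz)
    (yhat : T → Finset E → ℝ) (xhat : E → ℝ) (hWE : IsWE strat c d yhat xhat)
    (yhat' : T → Finset E → ℝ) (xhat' : E → ℝ) (hWE' : IsWE strat c d' yhat' xhat') :
    Real.sqrt (∑ e, (xhat' e - xhat e) ^ 2) ≤
      Real.sqrt (2 * ((Finset.univ.biUnion strat).sup' hne fun s => ∑ e ∈ s, c e α) / β) *
        Real.sqrt (∑ t, |d' t - d t|) := by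
  set C := (Finset.univ.biUnion strat).sup' hne fun s => ∑ e ∈ s, c e α with hCdef
  have hα : 0 ≤ α := (Finset.sum_nonneg fun t _ => hd t).trans hdtot
  have hleC : ∀ s ∈ Finset.univ.biUnion strat, ∑ e ∈ s, c e α ≤ C := fun s hs =>
    Finset.le_sup' (fun s => ∑ e ∈ s, c e α) hs
  have hC : 0 ≤ C := by
    obtain ⟨s, hs⟩ := hne
    exact (Finset.sum_nonneg fun e _ => hcpos e α hα).trans (hleC s hs)
  have hcost : ∀ z : E → ℝ, (∀ e, z e ∈ Set.Icc 0 α) → ∀ t, ∀ s ∈ strat t,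
      ∑ e ∈ s, c e (z e) ≤ C := fun z hz t s hs =>
    (Finset.sum_le_sum fun e _ => hmono e (hz e) ⟨hα, le_rfl⟩ (hz e).2).trans
      (hleC s (Finset.mem_biUnion.2 ⟨t, Finset.mem_univ t, hs⟩))
  have hx := hWE.1.load_mem_Icc hdtot
  have hx' := hWE'.1.load_mem_Icc hdtot'
  obtain ⟨l, hl, hmin, heq⟩ :=
    hWE.exists_type_cost (fun e => hcpos e _ (hx e).1) hC (hcost _ hx)
  obtain ⟨l', hl', hmin', heq'⟩ :=
    hWE'.exists_type_cost (fun e => hcpos e _ (hx' e).1) hC (hcost _ hx')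
  have hcross := hWE'.1.sum_mul_demand_le (p := fun e => c e (xhat e)) hmin
  have hcross' := hWE.1.sum_mul_demand_le (p := fun e => c e (xhat' e)) hmin'
  have hmain : β * ∑ e, (xhat' e - xhat e) ^ 2 ≤ C * ∑ t, |d' t - d t| := calc
    β * ∑ e, (xhat' e - xhat e) ^ 2
      ≤ ∑ e, (c e (xhat' e) - c e (xhat e)) * (xhat' e - xhat e) := by
        rw [Finset.mul_sum]
        exact Finset.sum_le_sum fun e _ =>
          mul_sq_sub_le_of_le_derivWithin_Icc (hderiv e) (hx e) (hx' e)
    _ ≤ ∑ t, (l' t - l t) * (d' t - d t) := by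
        simp only [sub_mul, mul_sub, Finset.sum_sub_distrib]
        linarith
    _ ≤ C * ∑ t, |d' t - d t| := by
        rw [Finset.mul_sum]
        refine Finset.sum_le_sum fun t _ => (le_abs_self _).trans ?_
        rw [abs_mul]
        refine mul_le_mul_of_nonneg_right (abs_le.2 ?_) (abs_nonneg _)
        constructor <;> linarith [(hl t).1, (hl t).2, (hl' t).1, (hl' t).2]
  rw [← Real.sqrt_mul (by positivity)]
  refine Real.sqrt_le_sqrt ?_
  have hD : 0 ≤ C * ∑ t, |d' t - d t| :=
    mul_nonneg hC (Finset.sum_nonneg fun t _ => abs_nonneg _)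
  rw [div_mul_eq_mul_div, le_div_iff₀ hβ]
  linarith
end
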